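/- arXiv:1310.4005 — 8 statements merged into one kernel-verified Lean document; each statement's English description precedes it below -/
import Mathlib

section
/- Let A be a commutative ℚ-algebra and (X_n)_{n≥1} a sequence in A. Define P_0 = 1 and P_n = (1/n) · Σ_{i=1}^n (−1)^{i+1} P_{n−i} X_i for n ≥ 1, and set c_i := i!·P_i. Then for every n ≥ 1: X_n = Σ_{j=1}^n (−1)^{n−j} · ((j−1)!/(n−1)!) · B_{n,j}(c_1, c_2, …, c_{n−j+1}), where B_{n,j} denotes the partial exponential Bell polynomial. -/
open scoped BigOperators

/-- The partial exponential Bell polynomial `B_{n,j}(x_1, …, x_{n-j+1})`, evaluated on a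
sequence `x` (indexed from 1): the sum over all sequences `(j_1, …, j_n)` of nonnegative
integers with `j_1 + j_2 + ⋯ = j` and `j_1 + 2 j_2 + 3 j_3 + ⋯ = n` of
`n! / (j_1! j_2! ⋯ (1!)^{j_1} (2!)^{j_2} ⋯) • x_1^{j_1} x_2^{j_2} ⋯`. -/
noncomputable def partialBell {A : Type*} [CommRing A] [Algebra ℚ A]
    (n j : ℕ) (x : ℕ → A) : A :=
  ∑ f ∈ (Fintype.piFinset fun _ : Fin n => Finset.range (n + 1)) |>.filter
      (fun f => (∑ i, f i) = j ∧ (∑ i : Fin n, (i.1 + 1) * f i) = n),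
    ((n.factorial : ℚ) /
        ∏ i : Fin n, (((f i).factorial : ℚ) * (((i.1 + 1).factorial : ℚ)) ^ (f i))) •
      ∏ i : Fin n, x (i.1 + 1) ^ f i

open PowerSeries in
/-- The coefficient of `X ^ n` in a power of a power series without constant term, as a sum over
exponent sequences. -/
theorem coeff_pow_eq_sum_multinomial {A : Type*} [CommRing A] (Q : A⟦X⟧)
    (hQ : constantCoeff Q = 0) (n j : ℕ) :
    coeff n (Q ^ j) = ∑ f ∈ (Finset.univ : Finset (Fin n)).piAntidiag j with
        ∑ i : Fin n, (i.1 + 1) * f i = n,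
      (Nat.multinomial Finset.univ f : A) * ∏ i : Fin n, coeff (i.1 + 1) Q ^ f i := by
  set T : A⟦X⟧ := ∑ i : Fin n, C (coeff (i.1 + 1) Q) * X ^ (i.1 + 1) with hT
  have hdvd : (X : A⟦X⟧) ^ (n + 1) ∣ Q - T := by
    rw [X_pow_dvd_iff]
    intro m hm
    rw [map_sub, hT, map_sum, sub_eq_zero]
    simp only [coeff_C_mul, coeff_X_pow]
    rcases m with _ | m
    · simpa using hQ
    · rw [Finset.sum_eq_single (⟨m, by omega⟩ : Fin n)]
      · simp
      · intro b _ hb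
        rw [if_neg, mul_zero]
        exact fun h => hb (Fin.ext (by simp only; omega))
      · simp
  have hcoeff : coeff n (Q ^ j) = coeff n (T ^ j) := by
    have := X_pow_dvd_iff.mp (hdvd.trans (sub_dvd_pow_sub_pow Q T j)) n (Nat.lt_succ_self n)
    rwa [map_sub, sub_eq_zero] at this
  rw [hcoeff, hT, Finset.sum_pow_eq_sum_piAntidiag, map_sum, Finset.sum_filter]
  refine Finset.sum_congr rfl fun f _ => ?_
  have hprod : ∏ i : Fin n, (C (coeff (i.1 + 1) Q) * (X : A⟦X⟧) ^ (i.1 + 1)) ^ f i =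
      C (∏ i : Fin n, coeff (i.1 + 1) Q ^ f i) * X ^ (∑ i : Fin n, (i.1 + 1) * f i) := by
    simp only [mul_pow, Finset.prod_mul_distrib, ← pow_mul, Finset.prod_pow_eq_pow_sum, map_prod,
      map_pow]
  have hcast : (Nat.multinomial Finset.univ f : A⟦X⟧) = C (Nat.multinomial Finset.univ f : A) :=
    (map_natCast C _).symm
  rw [hprod, hcast, coeff_C_mul, coeff_C_mul, coeff_X_pow]
  by_cases h : ∑ i : Fin n, (i.1 + 1) * f i = n
  · simp [h]
  · simp [h, Ne.symm h]

open PowerSeries in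
/-- The generating function of the partial Bell polynomials: up to a factor `n! / j!`, they are the
coefficients of the powers of the exponential generating function of their arguments. -/
theorem partialBell_eq_coeff_pow {A : Type*} [CommRing A] [Algebra ℚ A] (Q : A⟦X⟧)
    (hQ : constantCoeff Q = 0) (c : ℕ → A)
    (hc : ∀ i, c (i + 1) = ((i + 1).factorial : A) * coeff (i + 1) Q) (n j : ℕ) :
    partialBell n j c = ((n.factorial : ℚ) / j.factorial) • coeff n (Q ^ j) := by
  rw [coeff_pow_eq_sum_multinomial Q hQ, partialBell, Finset.smul_sum]
  refine Finset.sum_congr ?_ ?_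
  · ext f
    simp only [Finset.mem_filter, Fintype.mem_piFinset, Finset.mem_range, Finset.mem_piAntidiag,
      Finset.mem_univ, implies_true, and_true]
    refine ⟨And.right, fun h => ⟨fun i => ?_, h⟩⟩
    have := Finset.single_le_sum (f := fun i : Fin n => (i.1 + 1) * f i)
      (fun _ _ => Nat.zero_le _) (Finset.mem_univ i)
    have := Nat.le_mul_of_pos_left (f i) (Nat.succ_pos i.1)
    simp only [Nat.succ_eq_add_one] at *
    omega
  · intro f hf
    simp only [Finset.mem_filter, Finset.mem_piAntidiag] at hf
    have hspec := Nat.multinomial_spec (Finset.univ : Finset (Fin n)) f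
    rw [hf.1.1] at hspec
    have hj : (j.factorial : ℚ) =
        (∏ i, ((f i).factorial : ℚ)) * (Nat.multinomial Finset.univ f : ℚ) := by
      rw [← hspec]; push_cast; rfl
    have hprod : ∏ i : Fin n, c (i.1 + 1) ^ f i =
        (∏ i : Fin n, ((i.1 + 1).factorial : ℚ) ^ f i) •
          ∏ i : Fin n, coeff (i.1 + 1) Q ^ f i := by
      simp only [hc, mul_pow, Finset.prod_mul_distrib, Algebra.smul_def, map_prod, map_pow,
        map_natCast]
    have hmul : ((Nat.multinomial Finset.univ f : ℕ) : A) =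
        algebraMap ℚ A (Nat.multinomial Finset.univ f : ℚ) := (map_natCast _ _).symm
    rw [hprod, hmul, ← Algebra.smul_def, smul_smul, smul_smul, Finset.prod_mul_distrib]
    congr 1
    have h1 : ∏ i, ((f i).factorial : ℚ) ≠ 0 :=
      Finset.prod_ne_zero_iff.mpr fun i _ => by positivity
    have h2 : ∏ i : Fin n, ((i.1 + 1).factorial : ℚ) ^ f i ≠ 0 :=
      Finset.prod_ne_zero_iff.mpr fun i _ => by positivity
    have h3 : (Nat.multinomial Finset.univ f : ℚ) ≠ 0 := by
      intro h
      rw [h, mul_zero] at hj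
      exact Nat.cast_ne_zero.mpr j.factorial_ne_zero hj
    rw [hj]
    field_simp

open PowerSeries in
/-- If `X Q' = (1 + Q) G`, so that `G = X (log (1 + Q))'`, then the coefficients of `G` are given
by the logarithmic series. -/
theorem coeff_eq_sum_of_X_mul_derivative_eq {A : Type*} [CommRing A] [Algebra ℚ A] (Q G : A⟦X⟧)
    (hQ : constantCoeff Q = 0) (hG : X * d⁄dX A Q = (1 + Q) * G) (n : ℕ) :
    coeff n G = ∑ j ∈ Finset.range n,
      ((n : ℚ) / (j + 1 : ℕ)) • ((-1 : A) ^ j * coeff n (Q ^ (j + 1))) := by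
  have hX : (X : A⟦X⟧) ∣ Q := X_dvd_iff.mpr hQ
  have hunit : IsUnit (1 + Q) := by
    rw [isUnit_iff_constantCoeff]; simp [hQ]
  have hgeom : (1 + Q) * ∑ j ∈ Finset.range n, (-Q) ^ j = 1 - (-Q) ^ n := by
    rw [← mul_neg_geom_sum]; ring
  have hdiff : (1 + Q) * (X * d⁄dX A Q * (∑ j ∈ Finset.range n, (-Q) ^ j) - G) =
      -(X * d⁄dX A Q * (-Q) ^ n) := by
    linear_combination X * d⁄dX A Q * hgeom + hG
  have hdvd : (X : A⟦X⟧) ^ (n + 1) ∣ X * d⁄dX A Q * (∑ j ∈ Finset.range n, (-Q) ^ j) - G := by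
    rw [← hunit.dvd_mul_left, hdiff, dvd_neg, pow_succ']
    exact mul_dvd_mul (dvd_mul_right _ _) (pow_dvd_pow_of_dvd (hX.neg_right) n)
  have hcoeff := X_pow_dvd_iff.mp hdvd n (Nat.lt_succ_self n)
  rw [map_sub, sub_eq_zero] at hcoeff
  rw [← hcoeff, Finset.mul_sum, map_sum]
  refine Finset.sum_congr rfl fun j _ => ?_
  have hderiv : X * d⁄dX A (Q ^ (j + 1)) = C ((j + 1 : ℕ) : A) * (X * d⁄dX A Q * Q ^ j) := by
    rw [Derivation.leibniz_pow]
    simp only [Nat.add_sub_cancel, smul_eq_mul, nsmul_eq_mul, map_natCast]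
    ring
  have hXd : coeff n (X * d⁄dX A (Q ^ (j + 1))) = (n : A) * coeff n (Q ^ (j + 1)) := by
    rcases n with _ | n
    · simp
    · rw [coeff_succ_X_mul, coeff_derivative]; push_cast; ring
  rw [hderiv, coeff_C_mul] at hXd
  have hsign : X * d⁄dX A Q * (-Q) ^ j = C ((-1 : A) ^ j) * (X * d⁄dX A Q * Q ^ j) := by
    rw [neg_pow, map_pow, map_neg, map_one]; ring
  have hinv : algebraMap ℚ A ((j + 1 : ℕ) : ℚ)⁻¹ * ((j + 1 : ℕ) : A) = 1 := by
    rw [← map_natCast (algebraMap ℚ A), ← map_mul, inv_mul_cancel₀ (by positivity), map_one]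
  rw [hsign, coeff_C_mul, Algebra.smul_def, div_eq_mul_inv, (algebraMap ℚ A).map_mul,
    map_natCast (algebraMap ℚ A)]
  linear_combination (-1 : A) ^ j * (-coeff n (X * d⁄dX A Q * Q ^ j)) * hinv +
    (-1 : A) ^ j * algebraMap ℚ A ((j + 1 : ℕ) : ℚ)⁻¹ * hXd

theorem sum_Icc_one_eq_sum_range {M : Type*} [AddCommMonoid M] (f : ℕ → M) (n : ℕ) :
    ∑ i ∈ Finset.Icc 1 n, f i = ∑ i ∈ Finset.range n, f (i + 1) := by
  rw [Finset.range_eq_Ico, Finset.sum_Ico_add' f 0 n 1, zero_add]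
  rfl

/-- **Inversion of the Kailath–Segall formula.** If `P 0 = 1`,
`P n = (1/n) ∑_{i=1}^n (-1)^{i+1} P_{n-i} X_i` for `n ≥ 1`, and `c_i = i! P_i`, then
`X_n = ∑_{j=1}^n (-1)^{n-j} ((j-1)!/(n-1)!) B_{n,j}(c_1, …, c_{n-j+1})`. -/
theorem kailath_segall_inversion {A : Type*} [CommRing A] [Algebra ℚ A]
    (X : ℕ → A) (P : ℕ → A) (hP0 : P 0 = 1)
    (hP : ∀ n : ℕ, 1 ≤ n →
      P n = (n : ℚ)⁻¹ • ∑ i ∈ Finset.Icc 1 n, (-1 : A) ^ (i + 1) * P (n - i) * X i)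
    (c : ℕ → A) (hc : ∀ i : ℕ, c i = (i.factorial : A) * P i) :
    ∀ n : ℕ, 1 ≤ n →
      X n = ∑ j ∈ Finset.Icc 1 n,
        (((j - 1).factorial : ℚ) / ((n - 1).factorial : ℚ)) •
          ((-1 : A) ^ (n - j) * partialBell n j c) := by
  intro n hn
  set Q : PowerSeries A := PowerSeries.mk P - 1 with hQdef
  set G : PowerSeries A :=
    PowerSeries.mk fun i => if i = 0 then 0 else (-1 : A) ^ (i + 1) * X i with hGdef
  have hQ : PowerSeries.constantCoeff Q = 0 := by
    rw [hQdef, map_sub, ← PowerSeries.coeff_zero_eq_constantCoeff_apply]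
    simp [hP0]
  have hQcoeff : ∀ i, PowerSeries.coeff (i + 1) Q = P (i + 1) := by
    intro i
    simp [hQdef, PowerSeries.coeff_one]
  have hQG : PowerSeries.X * PowerSeries.derivative A Q = (1 + Q) * G := by
    ext m
    rcases m with _ | m
    · simp [hGdef]
    · rw [PowerSeries.coeff_succ_X_mul, PowerSeries.coeff_derivative, hQcoeff, hQdef,
        add_sub_cancel, mul_comm (PowerSeries.mk P), PowerSeries.coeff_mul,
        Finset.Nat.sum_antidiagonal_eq_sum_range_succ_mk, Finset.sum_range_succ']
      have hrec := congrArg (fun a => ((m + 1 : ℕ) : ℚ) • a) (hP (m + 1) (Nat.succ_pos m))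
      simp only [smul_smul] at hrec
      rw [mul_inv_cancel₀ (by positivity), one_smul, Algebra.smul_def, map_natCast,
        sum_Icc_one_eq_sum_range] at hrec
      simp only [hGdef, PowerSeries.coeff_mk, if_true, Nat.succ_ne_zero, if_false, zero_mul,
        add_zero]
      rw [mul_comm, ← Nat.cast_succ, hrec]
      exact Finset.sum_congr rfl fun i _ => by ring
  have hlog := coeff_eq_sum_of_X_mul_derivative_eq Q G hQ hQG n
  have hGn : X n = (-1 : A) ^ (n + 1) * PowerSeries.coeff n G := by
    rw [hGdef, PowerSeries.coeff_mk, if_neg (by omega), ← mul_assoc, ← mul_pow]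
    simp
  rw [hGn, hlog, Finset.mul_sum, sum_Icc_one_eq_sum_range]
  refine Finset.sum_congr rfl fun j hj => ?_
  rw [partialBell_eq_coeff_pow Q hQ c fun i => by rw [hc, hQcoeff]]
  have hjn : j + 1 ≤ n := Finset.mem_range.mp hj
  have hsign : (-1 : A) ^ (n + 1) * (-1) ^ j = (-1) ^ (n - (j + 1)) := by
    rw [← pow_add, show n + 1 + j = n - (j + 1) + 2 * (j + 1) by omega, pow_add, pow_mul]
    simp
  have hfact : (n : ℚ) / (j + 1 : ℕ) = ((j + 1 - 1).factorial : ℚ) / (n - 1).factorial *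
      ((n.factorial : ℚ) / (j + 1).factorial) := by
    rw [← Nat.mul_factorial_pred (by omega : n ≠ 0), Nat.add_sub_cancel, Nat.factorial_succ]
    push_cast
    field_simp
  rw [mul_smul_comm, mul_smul_comm, ← mul_assoc, hsign, smul_smul, hfact]
end

section
/- Let A be a commutative ℚ-algebra and (X_n)_{n≥1} a sequence in A. Define P_0 = 1 and P_n = (1/n) · Σ_{i=1}^n (−1)^{i+1} P_{n−i} X_i for n ≥ 1, and set p_i := (−1)^{i−1}(i−1)!·X_i. Then for every n ≥ 0: n!·P_n = Y_n(p_1, p_2, …, p_n), where Y_n denotes the complete exponential Bell polynomial. -/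
open scoped BigOperators

/-- The complete exponential Bell polynomial `Y_n(x_1, …, x_n) = ∑_{j=0}^n B_{n,j}`,
with `Y_0 = 1`. -/
noncomputable def completeBell {A : Type*} [CommRing A] [Algebra ℚ A]
    (n : ℕ) (x : ℕ → A) : A :=
  ∑ j ∈ Finset.range (n + 1), partialBell n j x

/-- Multiplicity functions `f` on `{1, …, N}` (shifted to `Fin N`) of total weight `n`. -/
def weightedMultiplicities (N n : ℕ) : Finset (Fin N → ℕ) :=
  (Fintype.piFinset fun _ : Fin N => Finset.range (n + 1)).filter
    fun f => ∑ i : Fin N, (i.1 + 1) * f i = n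

/-- The coefficient of `z ^ n` in `∏_{i=1}^N exp (y_i z ^ i)`. -/
noncomputable def expProdCoeff {A : Type*} [CommRing A] [Algebra ℚ A]
    (y : ℕ → A) (N n : ℕ) : A :=
  ∑ f ∈ weightedMultiplicities N n,
    ∏ i : Fin N, ((f i).factorial : ℚ)⁻¹ • y (i.1 + 1) ^ f i

theorem mem_weightedMultiplicities {N n : ℕ} {f : Fin N → ℕ} :
    f ∈ weightedMultiplicities N n ↔ ∑ i : Fin N, (i.1 + 1) * f i = n := by
  simp only [weightedMultiplicities, Finset.mem_filter, Fintype.mem_piFinset, Finset.mem_range,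
    and_iff_right_iff_imp]
  rintro rfl i
  have h := Finset.single_le_sum (f := fun i : Fin N => (i.1 + 1) * f i)
    (fun _ _ => Nat.zero_le _) (Finset.mem_univ i)
  have : f i ≤ (i.1 + 1) * f i := Nat.le_mul_of_pos_left _ i.1.succ_pos
  exact Nat.lt_succ_of_le (this.trans h)

theorem sum_weight_update_succ {N : ℕ} (g : Fin N → ℕ) (i : Fin N) :
    ∑ k : Fin N, (k.1 + 1) * Function.update g i (g i + 1) k =
      (∑ k : Fin N, (k.1 + 1) * g k) + (i.1 + 1) := by
  have : ∀ k : Fin N, (k.1 + 1) * Function.update g i (g i + 1) k =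
      (k.1 + 1) * g k + if k = i then i.1 + 1 else 0 := by
    intro k
    by_cases h : k = i
    · subst h; simp; ring
    · simp [h]
  simp [this, Finset.sum_add_distrib]

section

variable {A : Type*} [CommRing A] [Algebra ℚ A]

theorem succ_smul_prod_update_succ (y : ℕ → A) {N : ℕ} (g : Fin N → ℕ) (i : Fin N) :
    ((g i + 1 : ℕ) : ℚ) • ∏ k : Fin N,
        ((Function.update g i (g i + 1) k).factorial : ℚ)⁻¹ •
          y (k.1 + 1) ^ Function.update g i (g i + 1) k =
      y (i.1 + 1) * ∏ k : Fin N, ((g k).factorial : ℚ)⁻¹ • y (k.1 + 1) ^ g k := by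
  rw [← Finset.mul_prod_erase _ _ (Finset.mem_univ i),
    ← Finset.mul_prod_erase _ (fun k : Fin N => ((g k).factorial : ℚ)⁻¹ • y (k.1 + 1) ^ g k)
      (Finset.mem_univ i)]
  have h : ∀ k ∈ Finset.univ.erase i, ((Function.update g i (g i + 1) k).factorial : ℚ)⁻¹ •
      y (k.1 + 1) ^ Function.update g i (g i + 1) k =
      ((g k).factorial : ℚ)⁻¹ • y (k.1 + 1) ^ g k := by
    intro k hk
    rw [Function.update_of_ne (Finset.ne_of_mem_erase hk)]
  have hq : ((g i + 1 : ℕ) : ℚ) * (((g i + 1).factorial : ℕ) : ℚ)⁻¹ =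
      ((g i).factorial : ℚ)⁻¹ := by
    rw [Nat.factorial_succ]
    have : ((g i + 1 : ℕ) : ℚ) ≠ 0 := by positivity
    push_cast at this ⊢
    field_simp
  rw [Finset.prod_congr rfl h, Function.update_self, ← smul_mul_assoc, smul_smul, hq, pow_succ',
    ← mul_assoc, mul_smul_comm]

theorem sum_multiplicity_smul (y : ℕ → A) {N n : ℕ} (i : Fin N) (hi : i.1 + 1 ≤ n) :
    ∑ f ∈ weightedMultiplicities N n,
        (f i : ℚ) • ∏ k : Fin N, ((f k).factorial : ℚ)⁻¹ • y (k.1 + 1) ^ f k =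
      y (i.1 + 1) * expProdCoeff y N (n - (i.1 + 1)) := by
  rw [expProdCoeff, Finset.mul_sum, ← Finset.sum_filter_of_ne (p := fun f => f i ≠ 0)]
  · symm
    refine Finset.sum_bij' (fun g _ => Function.update g i (g i + 1))
      (fun f _ => Function.update f i (f i - 1)) ?_ ?_ ?_ ?_ ?_
    · intro g hg
      rw [mem_weightedMultiplicities] at hg
      rw [Finset.mem_filter, mem_weightedMultiplicities, sum_weight_update_succ, hg]
      simp only [Function.update_self]
      omega
    · intro f hf
      rw [Finset.mem_filter, mem_weightedMultiplicities] at hf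
      have h := sum_weight_update_succ (Function.update f i (f i - 1)) i
      rw [Function.update_self, Nat.sub_add_cancel (Nat.pos_of_ne_zero hf.2),
        Function.update_idem, Function.update_eq_self, hf.1] at h
      rw [mem_weightedMultiplicities]
      omega
    · intro g _
      simp
    · intro f hf
      have := Nat.sub_add_cancel (Nat.pos_of_ne_zero (Finset.mem_filter.1 hf).2)
      simp [this]
    · intro g _
      simpa using (succ_smul_prod_update_succ y g i).symm
  · intro f _ h h0
    simp [h0] at h

theorem smul_expProdCoeff_self (y : ℕ → A) (n : ℕ) :
    (n : ℚ) • expProdCoeff y n n =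
      ∑ i ∈ Finset.Icc 1 n, (i : ℚ) • (y i * expProdCoeff y n (n - i)) := by
  have hrange : ∑ i ∈ Finset.Icc 1 n, (i : ℚ) • (y i * expProdCoeff y n (n - i)) =
      ∑ i : Fin n, ((i.1 + 1 : ℕ) : ℚ) • (y (i.1 + 1) * expProdCoeff y n (n - (i.1 + 1))) := by
    rw [Fin.sum_univ_eq_sum_range
      (fun i => ((i + 1 : ℕ) : ℚ) • (y (i + 1) * expProdCoeff y n (n - (i + 1)))) n,
      Finset.range_eq_Ico, Finset.sum_Ico_add'
        (fun i : ℕ => (i : ℚ) • (y i * expProdCoeff y n (n - i))) 0 n 1]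
    rfl
  rw [hrange]
  simp_rw [← fun i : Fin n => sum_multiplicity_smul y i i.2, Finset.smul_sum]
  rw [Finset.sum_comm, expProdCoeff, Finset.smul_sum]
  refine Finset.sum_congr rfl fun f hf => ?_
  rw [mem_weightedMultiplicities] at hf
  simp_rw [smul_smul]
  rw [← Finset.sum_smul]
  congr 1
  exact_mod_cast hf.symm

theorem expProdCoeff_succ (y : ℕ → A) {N n : ℕ} (h : n ≤ N) :
    expProdCoeff y (N + 1) n = expProdCoeff y N n := by
  symm
  have hlast : ∀ f ∈ weightedMultiplicities (N + 1) n, f (Fin.last N) = 0 := by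
    intro f hf
    rw [mem_weightedMultiplicities, Fin.sum_univ_castSucc, Fin.val_last] at hf
    by_contra h0
    have := Nat.le_mul_of_pos_right (N + 1) (Nat.pos_of_ne_zero h0)
    omega
  refine Finset.sum_bij' (fun g _ => Fin.snoc (α := fun _ => ℕ) g 0) (fun f _ => Fin.init f)
    ?_ ?_ ?_ ?_ ?_
  · intro g hg
    rw [mem_weightedMultiplicities] at hg ⊢
    simpa [Fin.sum_univ_castSucc] using hg
  · intro f hf
    have h0 := hlast f hf
    rw [mem_weightedMultiplicities] at hf ⊢
    simpa [Fin.sum_univ_castSucc, h0, Fin.init] using hf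
  · intro g _
    simp
  · intro f hf
    rw [← hlast f hf, Fin.snoc_init_self]
  · intro g _
    simp [Fin.prod_univ_castSucc]

theorem expProdCoeff_eq_self (y : ℕ → A) {N n : ℕ} (h : n ≤ N) :
    expProdCoeff y N n = expProdCoeff y n n := by
  induction N, h using Nat.le_induction with
  | base => rfl
  | succ N h ih => rw [expProdCoeff_succ y h, ih]

theorem completeBell_eq_smul_expProdCoeff (n : ℕ) (x : ℕ → A) :
    completeBell n x =
      (n.factorial : ℚ) • expProdCoeff (fun i => (i.factorial : ℚ)⁻¹ • x i) n n := by
  have hmaps : ∀ f ∈ weightedMultiplicities n n, ∑ i, f i ∈ Finset.range (n + 1) := by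
    intro f hf
    rw [mem_weightedMultiplicities] at hf
    rw [Finset.mem_range, Nat.lt_succ_iff]
    calc ∑ i, f i ≤ ∑ i : Fin n, (i.1 + 1) * f i :=
          Finset.sum_le_sum fun i _ => Nat.le_mul_of_pos_left _ i.1.succ_pos
      _ = n := hf
  rw [expProdCoeff, Finset.smul_sum, ← Finset.sum_fiberwise_of_maps_to hmaps, completeBell]
  refine Finset.sum_congr rfl fun j _ => ?_
  rw [partialBell]
  refine Finset.sum_congr ?_ fun f _ => ?_
  · ext f
    simp only [weightedMultiplicities, Finset.mem_filter]
    tauto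
  · simp_rw [smul_pow, smul_smul]
    rw [Finset.prod_smul, smul_smul, div_eq_mul_inv, ← Finset.prod_inv_distrib]
    simp_rw [mul_inv, inv_pow]

end

/-- **Kailath–Segall polynomials are complete Bell polynomials.** If `P 0 = 1`,
`P n = (1/n) ∑_{i=1}^n (-1)^{i+1} P_{n-i} X_i` for `n ≥ 1`, and
`p_i = (-1)^{i-1} (i-1)! X_i`, then `n! P_n = Y_n(p_1, …, p_n)` for all `n ≥ 0`. -/
theorem kailath_segall_completeBell {A : Type*} [CommRing A] [Algebra ℚ A]
    (X : ℕ → A) (P : ℕ → A) (hP0 : P 0 = 1)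
    (hP : ∀ n : ℕ, 1 ≤ n →
      P n = (n : ℚ)⁻¹ • ∑ i ∈ Finset.Icc 1 n, (-1 : A) ^ (i + 1) * P (n - i) * X i)
    (p : ℕ → A) (hp : ∀ i : ℕ, p i = (-1 : A) ^ (i - 1) * ((i - 1).factorial : A) * X i) :
    ∀ n : ℕ, (n.factorial : A) * P n = completeBell n p := by
  set y : ℕ → A := fun i => (i.factorial : ℚ)⁻¹ • p i with hy
  have hyX : ∀ i : ℕ, 1 ≤ i → (i : ℚ) • y i = (-1 : A) ^ (i + 1) * X i := by
    intro i hi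
    obtain ⟨i, rfl⟩ := Nat.exists_eq_add_of_le' hi
    have hq : ((i + 1 : ℕ) : ℚ) * ((i + 1).factorial : ℚ)⁻¹ * (i.factorial : ℚ) = 1 := by
      rw [Nat.factorial_succ]
      have : ((i + 1 : ℕ) : ℚ) ≠ 0 := by positivity
      push_cast at this ⊢
      field_simp
    have hc : (i.factorial : A) * X (i + 1) = (i.factorial : ℚ) • X (i + 1) := by
      rw [Nat.cast_smul_eq_nsmul, nsmul_eq_mul]
    simp only [hy]
    rw [hp, Nat.add_sub_cancel, mul_assoc, hc, mul_smul_comm, smul_smul, smul_smul, hq, one_smul]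
    ring
  have hPy : ∀ n, P n = expProdCoeff y n n := by
    intro n
    induction n using Nat.strong_induction_on with
    | _ n ih =>
      rcases Nat.eq_zero_or_pos n with rfl | hn
      · simp [hP0, expProdCoeff, weightedMultiplicities]
      · have hn0 : (n : ℚ) ≠ 0 := by positivity
        rw [hP n hn, inv_smul_eq_iff₀ hn0, smul_expProdCoeff_self]
        refine Finset.sum_congr rfl fun i hi => ?_
        rw [Finset.mem_Icc] at hi
        rw [ih (n - i) (by omega), expProdCoeff_eq_self y (Nat.sub_le n i), ← smul_mul_assoc,
          hyX i hi.1]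
        ring
  intro n
  rw [completeBell_eq_smul_expProdCoeff, hPy, Nat.cast_smul_eq_nsmul, nsmul_eq_mul]
end

section
/- Let (X_t)_{t≥0} be a real-valued stochastic process on a probability space, adapted to a filtration (ℱ_t)_{t≥0}, with X_0 = 0 a.s., such that for all 0 ≤ v ≤ t the increment X_t − X_v is independent of ℱ_v and has the same distribution as X_{t−v}, and such that E[|X_t|^k] < ∞ for all k ≥ 0 and t ≥ 0. For t ≥ 0 define reals q_j(t) by q_0(t) = 1 and q_j(t) = −Σ_{i=0}^{j−1} binom(j,i) q_i(t) E[X_t^{j−i}] for j ≥ 1, and define the polynomials Q_k(x,t) := Σ_{j=0}^k binom(k,j) q_j(t) x^{k−j}. Then for every k ≥ 0 and all 0 ≤ v ≤ t, E[Q_k(X_t, t) | ℱ_v] = Q_k(X_v, v) almost surely. -/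
open MeasureTheory ProbabilityTheory
open scoped BigOperators NNReal

/-- The exponential generating function of a real sequence, as a formal power series. -/
noncomputable def expGenFun (a : ℕ → ℝ) : PowerSeries ℝ :=
  PowerSeries.mk fun n => a n / n.factorial

theorem expGenFun_injective : Function.Injective expGenFun := by
  intro a b h
  funext n
  have hn := congrArg (PowerSeries.coeff n) h
  simp only [expGenFun, PowerSeries.coeff_mk] at hn
  exact (div_left_inj' (Nat.cast_ne_zero.mpr n.factorial_ne_zero)).mp hn

/-- Products of exponential generating functions correspond to binomial convolutions. -/
theorem expGenFun_mul (a b : ℕ → ℝ) :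
    expGenFun a * expGenFun b =
      expGenFun fun n => ∑ i ∈ Finset.range (n + 1), (n.choose i : ℝ) * a i * b (n - i) := by
  ext n
  simp only [expGenFun, PowerSeries.coeff_mul, PowerSeries.coeff_mk]
  rw [Finset.Nat.sum_antidiagonal_eq_sum_range_succ
    (fun i j => a i / (i.factorial : ℝ) * (b j / (j.factorial : ℝ))), Finset.sum_div]
  refine Finset.sum_congr rfl fun i hi => ?_
  rw [Nat.cast_choose ℝ (Finset.mem_range_succ_iff.mp hi)]
  have := Nat.cast_ne_zero (R := ℝ).mpr n.factorial_ne_zero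
  field_simp

/-- A sequence given by the recursion for the inverse under binomial convolution has the inverse
exponential generating function. -/
theorem expGenFun_mul_eq_one {q m : ℕ → ℝ} (hm : m 0 = 1) (hq0 : q 0 = 1)
    (hq : ∀ j, 1 ≤ j → q j = -∑ i ∈ Finset.range j, (j.choose i : ℝ) * q i * m (j - i)) :
    expGenFun q * expGenFun m = 1 := by
  rw [expGenFun_mul]
  ext n
  rw [expGenFun, PowerSeries.coeff_mk, PowerSeries.coeff_one]
  rcases Nat.eq_zero_or_pos n with rfl | hn
  · simp [hm, hq0]
  · rw [Finset.sum_range_succ, if_neg hn.ne']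
    have := hq n hn
    simp only [Nat.choose_self, Nat.cast_one, one_mul, Nat.sub_self, hm, mul_one]
    rw [this]
    simp

/-- Conditional moments of the sum of an `m`-measurable variable `Y` and a variable `D`
independent of `m`. -/
theorem condExp_add_pow_of_indep {Ω : Type*} {m m0 : MeasurableSpace Ω} {μ : Measure Ω}
    [IsProbabilityMeasure μ] (hm : m ≤ m0) {Y D : Ω → ℝ}
    (hY : Measurable[m] Y) (hD : Measurable D)
    (hindep : Indep (MeasurableSpace.comap D inferInstance) m μ)
    (hYint : ∀ n : ℕ, Integrable (fun ω => Y ω ^ n) μ)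
    (hDint : ∀ n : ℕ, Integrable (fun ω => D ω ^ n) μ) (n : ℕ) :
    μ[fun ω => (Y ω + D ω) ^ n | m] =ᵐ[μ]
      fun ω => ∑ i ∈ Finset.range (n + 1), (n.choose i : ℝ) * Y ω ^ i * ∫ ω', D ω' ^ (n - i) ∂μ := by
  have hYD : IndepFun Y D μ :=
    (indep_of_indep_of_le_right hindep hY.comap_le).symm
  have hint (i j : ℕ) : Integrable ((fun ω => (n.choose i : ℝ) * Y ω ^ i) * fun ω => D ω ^ j) μ :=
    (hYD.comp (φ := fun y => (n.choose i : ℝ) * y ^ i) (ψ := fun d => d ^ j)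
      (by fun_prop) (by fun_prop)).integrable_mul ((hYint i).const_mul _) (hDint j)
  have hsum : (fun ω => (Y ω + D ω) ^ n) = ∑ i ∈ Finset.range (n + 1),
      (fun ω => (n.choose i : ℝ) * Y ω ^ i) * fun ω => D ω ^ (n - i) := by
    funext ω
    rw [add_pow, Finset.sum_apply]
    refine Finset.sum_congr rfl fun i _ => ?_
    simp only [Pi.mul_apply]
    ring
  have hterm (i : ℕ) : ∀ᵐ ω ∂μ,
      (μ[(fun ω => (n.choose i : ℝ) * Y ω ^ i) * fun ω => D ω ^ (n - i) | m]) ω =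
        (n.choose i : ℝ) * Y ω ^ i * ∫ ω', D ω' ^ (n - i) ∂μ := by
    have hpull := condExp_mul_of_stronglyMeasurable_left (m := m)
      ((hY.pow_const i).const_mul (n.choose i : ℝ)).stronglyMeasurable
      (hint i (n - i)) (hDint (n - i))
    have hconst := condExp_indep_eq hD.comap_le hm
      ((comap_measurable D).pow_const (n - i)).stronglyMeasurable hindep
    filter_upwards [hpull, hconst] with ω h1 h2
    rw [h1, Pi.mul_apply, h2]
  rw [hsum]
  filter_upwards [condExp_finsetSum (fun i _ => hint i (n - i)) m, ae_all_iff.mpr hterm]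
    with ω h1 h2
  rw [h1, Finset.sum_apply]
  exact Finset.sum_congr rfl fun i _ => h2 i

/-- **Time-space harmonic polynomials with respect to a Lévy process.** Let `(X_t)_{t≥0}` be
adapted to a filtration `ℱ`, with `X_0 = 0` a.s., increments `X_t - X_v` independent of `ℱ_v`
and distributed as `X_{t-v}`, and all moments finite. Define `q_j(t)` by `q_0(t) = 1` and
`q_j(t) = -∑_{i=0}^{j-1} C(j,i) q_i(t) E[X_t^{j-i}]`, and set
`Q_k(x,t) = ∑_{j=0}^k C(k,j) q_j(t) x^{k-j}`. Then for all `k` and `v ≤ t`,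
`E[Q_k(X_t,t) | ℱ_v] = Q_k(X_v,v)` a.s. -/
theorem tsh_polynomials_levy {Ω : Type*} [m0 : MeasurableSpace Ω]
    (μ : Measure Ω) [IsProbabilityMeasure μ]
    (ℱ : Filtration ℝ≥0 m0) (X : ℝ≥0 → Ω → ℝ) (hadapted : Adapted ℱ X)
    (h0 : ∀ᵐ ω ∂μ, X 0 ω = 0)
    (hindep : ∀ v t : ℝ≥0, v ≤ t →
      Indep (MeasurableSpace.comap (fun ω => X t ω - X v ω) inferInstance) (ℱ v) μ)
    (hstat : ∀ v t : ℝ≥0, v ≤ t →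
      Measure.map (fun ω => X t ω - X v ω) μ = Measure.map (X (t - v)) μ)
    (hmom : ∀ (k : ℕ) (t : ℝ≥0), Integrable (fun ω => |X t ω| ^ k) μ)
    (q : ℝ≥0 → ℕ → ℝ) (hq0 : ∀ t : ℝ≥0, q t 0 = 1)
    (hq : ∀ (t : ℝ≥0) (j : ℕ), 1 ≤ j →
      q t j = -∑ i ∈ Finset.range j, (j.choose i : ℝ) * q t i * ∫ ω, (X t ω) ^ (j - i) ∂μ)
    (Q : ℕ → ℝ → ℝ≥0 → ℝ)
    (hQ : ∀ (k : ℕ) (x : ℝ) (t : ℝ≥0),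
      Q k x t = ∑ j ∈ Finset.range (k + 1), (k.choose j : ℝ) * q t j * x ^ (k - j)) :
    ∀ (k : ℕ) (v t : ℝ≥0), v ≤ t →
      μ[fun ω => Q k (X t ω) t | ℱ v] =ᵐ[μ] fun ω => Q k (X v ω) v := by
  intro k v t hvt
  have hX (s : ℝ≥0) : Measurable (X s) := (hadapted s).mono (ℱ.le s) le_rfl
  have hint (n : ℕ) (s : ℝ≥0) : Integrable (fun ω => X s ω ^ n) μ := by
    refine (integrable_norm_iff ((hX s).pow_const n).aestronglyMeasurable).mp ?_
    simpa [norm_pow, Real.norm_eq_abs] using hmom n s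
  have hident : IdentDistrib (fun ω => X t ω - X v ω) (X (t - v)) μ μ :=
    ⟨((hX t).sub (hX v)).aemeasurable, (hX _).aemeasurable, hstat v t hvt⟩
  have hidentpow (n : ℕ) :
      IdentDistrib (fun ω => (X t ω - X v ω) ^ n) (fun ω => X (t - v) ω ^ n) μ μ :=
    hident.comp (measurable_id.pow_const n)
  let M : ℝ≥0 → ℕ → ℝ := fun s n => ∫ ω, X s ω ^ n ∂μ
  have hcond (n : ℕ) : μ[fun ω => X t ω ^ n | ℱ v] =ᵐ[μ]
      fun ω => ∑ i ∈ Finset.range (n + 1), (n.choose i : ℝ) * X v ω ^ i * M (t - v) (n - i) := by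
    have := condExp_add_pow_of_indep (D := fun ω => X t ω - X v ω) (ℱ.le v) (hadapted v)
      ((hX t).sub (hX v)) (hindep v t hvt)
      (fun n => hint n v) (fun n => (hidentpow n).integrable_iff.mpr (hint n _)) n
    simpa only [add_sub_cancel, (hidentpow _).integral_eq] using this
  have hM : expGenFun (M t) = expGenFun (M v) * expGenFun (M (t - v)) := by
    rw [expGenFun_mul]
    congr 1
    funext n
    change ∫ ω, X t ω ^ n ∂μ = _
    rw [← integral_condExp (ℱ.le v), integral_congr_ae (hcond n),
      integral_finsetSum _ fun i _ => ((hint i v).const_mul _).mul_const _]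
    refine Finset.sum_congr rfl fun i _ => ?_
    rw [integral_mul_const, integral_const_mul]
  have hinv (s : ℝ≥0) : expGenFun (q s) * expGenFun (M s) = 1 :=
    expGenFun_mul_eq_one (by simp [M]) (hq0 s) (hq s)
  have hqv : expGenFun (q t) * expGenFun (M (t - v)) = expGenFun (q v) := by
    have ht := hinv t
    rw [hM] at ht
    linear_combination expGenFun (q v) * ht - expGenFun (q t) * expGenFun (M (t - v)) * hinv v
  have hsum : (fun ω => Q k (X t ω) t) = ∑ j ∈ Finset.range (k + 1),
      ((k.choose j : ℝ) * q t j) • fun ω => X t ω ^ (k - j) := by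
    funext ω
    simp [hQ, Finset.sum_apply]
  rw [hsum]
  filter_upwards [condExp_finsetSum (s := Finset.range (k + 1))
      (fun j _ => (hint (k - j) t).smul ((k.choose j : ℝ) * q t j)) (ℱ v),
    ae_all_iff.mpr fun j => condExp_smul (μ := μ) ((k.choose j : ℝ) * q t j)
      (fun ω => X t ω ^ (k - j)) (ℱ v),
    ae_all_iff.mpr hcond] with ω h1 h2 h3
  rw [h1, Finset.sum_apply, hQ]
  simp only [h2, Pi.smul_apply, smul_eq_mul, h3]
  have key : expGenFun (q t) * (expGenFun (fun n => X v ω ^ n) * expGenFun (M (t - v))) =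
      expGenFun (q v) * expGenFun (fun n => X v ω ^ n) := by
    linear_combination expGenFun (fun n => X v ω ^ n) * hqv
  simp only [expGenFun_mul] at key
  exact congrFun (expGenFun_injective key) k
end

section
/- For μ ∈ ℝ define the Poisson–Charlier polynomial C̃_k(x, μ) := Σ_{j=0}^k binom(k,j) (−μ)^{k−j} (x)_j, where (x)_j = x(x−1)⋯(x−j+1) is the falling factorial. Define Q_j(x, μ) := Σ_{i=0}^j binom(j,i) q_i(μ) x^{j−i} where q_i(μ) := Σ_{l=0}^i S(i,l)(−μ)^l and S(i,l) are the Stirling numbers of the second kind. Then for all k ≥ 0, x ∈ ℝ, μ ∈ ℝ: C̃_k(x, μ) = Σ_{j=0}^k s(k,j) Q_j(x, μ), where s(k,j) are the signed Stirling numbers of the first kind, defined by (x)_k = Σ_{j=0}^k s(k,j) x^j. -/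
open scoped BigOperators

/-- The Stirling numbers of the second kind `S(n, l)`. -/
def stirling2 : ℕ → ℕ → ℕ
  | 0, 0 => 1
  | 0, _ + 1 => 0
  | _ + 1, 0 => 0
  | n + 1, l + 1 => (l + 1) * stirling2 n (l + 1) + stirling2 n l

/-- The Poisson–Charlier polynomial `C̃_k(x, μ) = ∑_{j=0}^k C(k,j) (-μ)^{k-j} (x)_j`,
where `(x)_j` is the falling factorial. -/
noncomputable def poissonCharlier (k : ℕ) (x μ : ℝ) : ℝ :=
  ∑ j ∈ Finset.range (k + 1),
    (k.choose j : ℝ) * (-μ) ^ (k - j) * (descPochhammer ℝ j).eval x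

/-- `q_i(μ) = ∑_{l=0}^i S(i,l) (-μ)^l`. -/
noncomputable def qCharlier (i : ℕ) (μ : ℝ) : ℝ :=
  ∑ l ∈ Finset.range (i + 1), (stirling2 i l : ℝ) * (-μ) ^ l

/-- The time-space harmonic polynomials `Q_j(x, μ) = ∑_{i=0}^j C(j,i) q_i(μ) x^{j-i}`
of the Poisson process. -/
noncomputable def QCharlier (j : ℕ) (x μ : ℝ) : ℝ :=
  ∑ i ∈ Finset.range (j + 1), (j.choose i : ℝ) * qCharlier i μ * x ^ (j - i)

open Polynomial in
theorem descPochhammer_eval_add {R : Type*} [CommRing R] (a b : R) (k : ℕ) :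
    (descPochhammer R k).eval (a + b) = ∑ j ∈ Finset.range (k + 1),
      (k.choose j : R) * ((descPochhammer R j).eval a * (descPochhammer R (k - j)).eval b) := by
  have smeval_eq (n : ℕ) (r : R) : (descPochhammer ℤ n).smeval r = (descPochhammer R n).eval r := by
    rw [← aeval_eq_smeval, ← descPochhammer_map (algebraMap ℤ R), eval_map_algebraMap]
  have h := Ring.descPochhammer_smeval_add k (Commute.all a b)
  simp only [smeval_eq] at h
  rw [h, Finset.Nat.sum_antidiagonal_eq_sum_range_succ_mk]

theorem stirling2_eq_zero_of_lt : ∀ {n l : ℕ}, n < l → stirling2 n l = 0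
  | 0, 0, h => absurd h (lt_irrefl 0)
  | 0, _ + 1, _ => rfl
  | _ + 1, 0, h => absurd h (Nat.not_lt_zero _)
  | n + 1, l + 1, h => by
    rw [stirling2, stirling2_eq_zero_of_lt (by omega), stirling2_eq_zero_of_lt (by omega)]
    simp

theorem stirling2_self (n : ℕ) : stirling2 n n = 1 := by
  induction n with
  | zero => rfl
  | succ n ih => simp [stirling2, ih, stirling2_eq_zero_of_lt]

open Polynomial in
theorem X_pow_eq_sum_stirling2_smul_descPochhammer (R : Type*) [CommRing R] (n : ℕ) :
    (X ^ n : R[X]) = ∑ l ∈ Finset.range (n + 1), (stirling2 n l : R) • descPochhammer R l := by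
  induction n with
  | zero => simp [stirling2]
  | succ n ih =>
    have X_mul_descPochhammer (l : ℕ) :
        descPochhammer R l * X = descPochhammer R (l + 1) + (l : R) • descPochhammer R l := by
      rw [descPochhammer_succ_right, smul_eq_C_mul, C_eq_natCast]
      ring
    have hshift : ∑ l ∈ Finset.range (n + 1), (l : R) • (stirling2 n l : R) • descPochhammer R l =
        ∑ l ∈ Finset.range (n + 1),
          ((l + 1 : ℕ) : R) • (stirling2 n (l + 1) : R) • descPochhammer R (l + 1) := by
      have h := Finset.sum_range_succ
        (fun l => (l : R) • (stirling2 n l : R) • descPochhammer R l) (n + 1)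
      rw [Finset.sum_range_succ', stirling2_eq_zero_of_lt (Nat.lt_succ_self n)] at h
      simpa using h.symm
    rw [pow_succ, ih, Finset.sum_mul, Finset.sum_range_succ' _ (n + 1)]
    simp only [smul_mul_assoc, X_mul_descPochhammer, smul_add, Finset.sum_add_distrib]
    simp only [smul_comm (stirling2 n _ : R) (_ : R)]
    rw [hshift, ← Finset.sum_add_distrib]
    simp only [stirling2, Nat.cast_zero, zero_smul, add_zero]
    refine Finset.sum_congr rfl fun l _ => ?_
    push_cast
    module

/-- The linear functional on polynomials with moments `q_i(μ)`. -/
noncomputable def charlierFunctional (μ : ℝ) : Polynomial ℝ →ₗ[ℝ] ℝ :=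
  Polynomial.lsum fun i => LinearMap.mulRight ℝ (qCharlier i μ)

open Polynomial in
theorem charlierFunctional_X_pow (μ : ℝ) (i : ℕ) :
    charlierFunctional μ (X ^ i) = qCharlier i μ := by
  simp [charlierFunctional, lsum_apply, ← monomial_one_right_eq_X_pow, sum_monomial_index]

theorem charlierFunctional_descPochhammer (μ : ℝ) (l : ℕ) :
    charlierFunctional μ (descPochhammer ℝ l) = (-μ) ^ l := by
  induction l using Nat.strong_induction_on with
  | _ l ih =>
    have h := charlierFunctional_X_pow μ l
    rw [X_pow_eq_sum_stirling2_smul_descPochhammer, map_sum, qCharlier, Finset.sum_range_succ,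
      Finset.sum_range_succ, Finset.sum_congr rfl fun m hm => by
        rw [map_smul, ih m (Finset.mem_range.mp hm), smul_eq_mul]] at h
    simpa [stirling2_self] using h

open Polynomial in
theorem charlierFunctional_X_add_C_pow (x μ : ℝ) (j : ℕ) :
    charlierFunctional μ ((X + C x) ^ j) = QCharlier j x μ := by
  rw [add_pow, map_sum, QCharlier]
  refine Finset.sum_congr rfl fun i _ => ?_
  have h : (X ^ i * C x ^ (j - i) * (j.choose i : ℝ[X])) =
      ((j.choose i : ℝ) * x ^ (j - i)) • X ^ i := by
    rw [smul_eq_C_mul, C_mul, C_pow, C_eq_natCast]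
    ring
  rw [h, map_smul, charlierFunctional_X_pow, smul_eq_mul]
  ring

open Polynomial in
theorem descPochhammer_comp_X_add_C {R : Type*} [CommRing R] (x : R) (k : ℕ) :
    (descPochhammer R k).comp (X + C x) = ∑ j ∈ Finset.range (k + 1),
      ((k.choose j : R) * (descPochhammer R j).eval x) • descPochhammer R (k - j) := by
  have eval_eq (n : ℕ) (p : R[X]) :
      (descPochhammer R[X] n).eval p = (descPochhammer R n).comp p := by
    rw [← descPochhammer_map (C : R →+* R[X]), eval_map, comp]
  rw [← eval_eq, add_comm, descPochhammer_eval_add]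
  refine Finset.sum_congr rfl fun j _ => ?_
  rw [eval_eq, eval_eq, comp_C, comp_X, smul_eq_C_mul, C_mul, C_eq_natCast, mul_assoc]

/-- **Poisson–Charlier polynomials as Stirling combinations of the time-space harmonic
polynomials of the Poisson process**: `C̃_k(x, μ) = ∑_{j=0}^k s(k,j) Q_j(x, μ)`, where the
signed Stirling numbers of the first kind `s(k,j)` are the coefficients of the falling
factorial polynomial `(x)_k = ∑_j s(k,j) x^j`. -/
theorem poissonCharlier_eq_stirling_sum (k : ℕ) (x μ : ℝ) :
    poissonCharlier k x μ =
      ∑ j ∈ Finset.range (k + 1), (descPochhammer ℝ k).coeff j * QCharlier j x μ := by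
  have h := congrArg (charlierFunctional μ) (descPochhammer_comp_X_add_C x k)
  rw [Polynomial.comp, Polynomial.eval₂_eq_sum_range, descPochhammer_natDegree] at h
  simp only [map_sum, ← Polynomial.smul_eq_C_mul, map_smul, charlierFunctional_X_add_C_pow,
    charlierFunctional_descPochhammer, smul_eq_mul] at h
  rw [h, poissonCharlier]
  exact Finset.sum_congr rfl fun j _ => mul_right_comm _ _ _
end

section
/- For μ ∈ ℝ define the Poisson–Charlier polynomial C̃_k(x, μ) := Σ_{j=0}^k binom(k,j) (−μ)^{k−j} (x)_j, where (x)_j = x(x−1)⋯(x−j+1) is the falling factorial. Let λ > 0 and 0 ≤ v ≤ t. Then for every k ≥ 0 and x ∈ ℝ: Σ_{n=0}^∞ e^{−λ(t−v)} (λ(t−v))^n/n! · C̃_k(x + n, λt) = C̃_k(x, λv). -/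
open scoped BigOperators

/-- The three-term recurrence `C̃_{k+1}(x, μ) = x C̃_k(x - 1, μ) - μ C̃_k(x, μ)`. -/
theorem poissonCharlier_succ (k : ℕ) (x μ : ℝ) :
    poissonCharlier (k + 1) x μ = x * poissonCharlier k (x - 1) μ - μ * poissonCharlier k x μ := by
  unfold poissonCharlier
  have h := Finset.sum_choose_succ_mul
    (fun i j => (-μ) ^ j * (descPochhammer ℝ i).eval x) k
  simp only [← mul_assoc] at h
  rw [h, sub_eq_add_neg, ← neg_mul, add_comm, Finset.mul_sum, Finset.mul_sum]
  congr 1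
  · refine Finset.sum_congr rfl fun j _ => ?_
    simp only [descPochhammer_succ_left, Polynomial.eval_mul, Polynomial.eval_comp,
      Polynomial.eval_sub, Polynomial.eval_X, Polynomial.eval_one]
    ring
  · refine Finset.sum_congr rfl fun j hj => ?_
    rw [Nat.succ_sub (Finset.mem_range_succ_iff.mp hj), pow_succ]
    ring

/-- The size-biasing identity of the Poisson distribution: if `∑ P(n) g(n) = s` for Poisson weights
`P` with parameter `a`, then `∑ P(n) n g(n - 1) = a s`. -/
theorem hasSum_poisson_mul_natCast {a s : ℝ} {f g : ℕ → ℝ} (hfg : ∀ n, f (n + 1) = g n)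
    (hg : HasSum (fun n : ℕ => Real.exp (-a) * a ^ n / (n.factorial : ℝ) * g n) s) :
    HasSum (fun n : ℕ => Real.exp (-a) * a ^ n / (n.factorial : ℝ) * (n * f n)) (a * s) := by
  rw [← hasSum_nat_add_iff' 1]
  simp only [Finset.range_one, Finset.sum_singleton, Nat.cast_zero, zero_mul, mul_zero, sub_zero]
  refine (hg.mul_left a).congr_fun ?_
  intro n
  have h₁ : (n.factorial : ℝ) ≠ 0 := by positivity
  have h₂ : ((n : ℝ) + 1) ≠ 0 := by positivity
  rw [hfg, Nat.factorial_succ]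
  push_cast
  field_simp
  ring

/-- Averaging `C̃_k(x + ·, μ)` against the Poisson distribution with parameter `a` yields
`C̃_k(x, μ - a)`. -/
theorem hasSum_poisson_mul_poissonCharlier (a μ : ℝ) (k : ℕ) (x : ℝ) :
    HasSum (fun n : ℕ => Real.exp (-a) * a ^ n / (n.factorial : ℝ) * poissonCharlier k (x + n) μ)
      (poissonCharlier k x (μ - a)) := by
  induction k generalizing x with
  | zero =>
    have h := (NormedSpace.expSeries_div_hasSum_exp a).mul_left (Real.exp (-a))
    rw [← Real.exp_eq_exp_ℝ, ← Real.exp_add, neg_add_cancel, Real.exp_zero] at h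
    simpa [poissonCharlier, mul_div_assoc] using h
  | succ k ih =>
    have h := (((ih (x - 1)).mul_left x).add (hasSum_poisson_mul_natCast
      (f := fun n : ℕ => poissonCharlier k (x + n - 1) μ)
      (fun n => by push_cast; ring_nf) (ih x))).sub ((ih x).mul_left μ)
    have hs : poissonCharlier (k + 1) x (μ - a) = x * poissonCharlier k (x - 1) (μ - a) +
        a * poissonCharlier k x (μ - a) - μ * poissonCharlier k x (μ - a) := by
      rw [poissonCharlier_succ]
      ring
    rw [hs]
    refine h.congr_fun fun n => ?_
    rw [poissonCharlier_succ, sub_add_eq_add_sub]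
    ring

/-- **Time-space harmonicity of the Poisson–Charlier polynomials with respect to the
Poisson process**: for `λ > 0` and `0 ≤ v ≤ t`, averaging `C̃_k(x + ·, λt)` against the
Poisson distribution with parameter `λ(t - v)` yields `C̃_k(x, λv)`. -/
theorem poissonCharlier_tsh (lam : ℝ) (hlam : 0 < lam) (v t : ℝ) (hv : 0 ≤ v) (hvt : v ≤ t) :
    ∀ (k : ℕ) (x : ℝ),
      ∑' n : ℕ, Real.exp (-(lam * (t - v))) * (lam * (t - v)) ^ n / (n.factorial : ℝ) *
          poissonCharlier k (x + n) (lam * t)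
        = poissonCharlier k x (lam * v) := by
  intro k x
  rw [(hasSum_poisson_mul_poissonCharlier (lam * (t - v)) (lam * t) k x).tsum_eq]
  congr 1
  ring
end

section
/- For t ∈ ℝ define L̃_k(x, t) := Σ_{j=0}^k binom(k,j) (−1)^j (t)_j x^{k−j}, where (t)_j = t(t−1)⋯(t−j+1) is the falling factorial (so L̃_k(x,t) = (−1)^k k! 𝔏_k^{t−k}(x) with 𝔏 the generalized Laguerre polynomials). Let 0 ≤ v < t. Then for every k ≥ 0 and x ∈ ℝ: ∫_0^∞ L̃_k(x + g, t) · (g^{t−v−1} e^{−g}/Γ(t−v)) dg = L̃_k(x, v). -/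
open MeasureTheory
open scoped BigOperators

/-- `L̃_k(x, t) = ∑_{j=0}^k C(k,j) (-1)^j (t)_j x^{k-j}`, where `(t)_j` is the falling
factorial; so `L̃_k(x,t) = (-1)^k k! 𝔏_k^{t-k}(x)` with `𝔏` the generalized Laguerre
polynomials. -/
noncomputable def laguerreTilde (k : ℕ) (x t : ℝ) : ℝ :=
  ∑ j ∈ Finset.range (k + 1),
    (k.choose j : ℝ) * (-1) ^ j * (descPochhammer ℝ j).eval t * x ^ (k - j)

open PowerSeries in
theorem coeff_rescale_exp (a : ℝ) (n : ℕ) :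
    coeff n (rescale a (exp ℝ)) = a ^ n / n.factorial := by
  simp [coeff_rescale, coeff_exp, div_eq_mul_inv]

open PowerSeries in
theorem coeff_rescale_neg_one_binomialSeries (t : ℝ) (n : ℕ) :
    coeff n (rescale (-1) (binomialSeries ℝ t)) =
      (-1) ^ n * (descPochhammer ℝ n).eval t / n.factorial := by
  rw [coeff_rescale, binomialSeries_coeff, Ring.choose_eq_smul, ← Polynomial.aeval_eq_smeval,
    ← Polynomial.eval_map_algebraMap, descPochhammer_map, smul_eq_mul, smul_eq_mul]
  ring

open PowerSeries in
/-- The generating function `∑ L̃_k(x, t) z ^ k / k! = (1 - z) ^ t * exp (z x)`. -/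
theorem laguerreTilde_eq_coeff (k : ℕ) (x t : ℝ) :
    laguerreTilde k x t = k.factorial *
      coeff k (rescale (-1) (binomialSeries ℝ t) * rescale x (exp ℝ)) := by
  rw [coeff_mul, Finset.Nat.sum_antidiagonal_eq_sum_range_succ_mk, laguerreTilde, Finset.mul_sum]
  refine Finset.sum_congr rfl fun j hj => ?_
  rw [coeff_rescale_exp, coeff_rescale_neg_one_binomialSeries,
    Nat.cast_choose ℝ (Finset.mem_range_succ_iff.mp hj)]
  ring

/-- The power `x ^ n` is integrable against the unnormalised Gamma density of shape `a`. -/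
theorem integrableOn_pow_mul_rpow_mul_exp_neg {a : ℝ} (ha : 0 < a) (n : ℕ) :
    IntegrableOn (fun g : ℝ => g ^ n * (g ^ (a - 1) * Real.exp (-g))) (Set.Ioi 0) := by
  refine (Real.GammaIntegral_convergent (s := a + n) (by positivity)).congr_fun (fun g hg => ?_)
    measurableSet_Ioi
  simp only
  rw [add_sub_right_comm, Real.rpow_add_natCast (ne_of_gt hg)]
  ring

theorem integral_pow_mul_rpow_mul_exp_neg {a : ℝ} (ha : 0 < a) (n : ℕ) :
    ∫ g in Set.Ioi (0 : ℝ), g ^ n * (g ^ (a - 1) * Real.exp (-g)) = Real.Gamma (a + n) := by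
  rw [Real.Gamma_eq_integral (by positivity)]
  refine setIntegral_congr_fun measurableSet_Ioi fun g hg => ?_
  rw [add_sub_right_comm, Real.rpow_add_natCast (ne_of_gt hg)]
  ring

theorem Gamma_add_nat_eq_ascPochhammer_mul {a : ℝ} (ha : 0 < a) (n : ℕ) :
    Real.Gamma (a + n) = (ascPochhammer ℝ n).eval a * Real.Gamma a := by
  induction n with
  | zero => simp
  | succ n ih =>
    rw [Nat.cast_succ, ← add_assoc, Real.Gamma_add_one (by positivity), ih,
      ascPochhammer_succ_eval]
    ring

open PowerSeries in
/-- The moment generating function of the Gamma distribution of shape `a` and rate `1` is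
`(1 - z) ^ (-a)`. -/
theorem integral_coeff_rescale_exp_mul_gamma {a : ℝ} (ha : 0 < a) (n : ℕ) :
    ∫ g in Set.Ioi (0 : ℝ), coeff n (rescale g (exp ℝ)) *
        (g ^ (a - 1) * Real.exp (-g) / Real.Gamma a) =
      coeff n (rescale (-1) (binomialSeries ℝ (-a))) := by
  have hΓ : Real.Gamma a ≠ 0 := (Real.Gamma_pos_of_pos ha).ne'
  have h (g : ℝ) : coeff n (rescale g (exp ℝ)) * (g ^ (a - 1) * Real.exp (-g) / Real.Gamma a) =
      g ^ n * (g ^ (a - 1) * Real.exp (-g)) * (n.factorial * Real.Gamma a)⁻¹ := by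
    rw [coeff_rescale_exp]
    field_simp
  simp_rw [h]
  rw [integral_mul_const, integral_pow_mul_rpow_mul_exp_neg ha,
    Gamma_add_nat_eq_ascPochhammer_mul ha, coeff_rescale_neg_one_binomialSeries,
    ← ascPochhammer_eval_neg_eq_descPochhammer, neg_neg]
  field_simp

open PowerSeries in
theorem integrableOn_coeff_rescale_exp_mul_gamma {a : ℝ} (ha : 0 < a) (n : ℕ) :
    IntegrableOn (fun g : ℝ => coeff n (rescale g (exp ℝ)) *
      (g ^ (a - 1) * Real.exp (-g) / Real.Gamma a)) (Set.Ioi 0) := by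
  refine ((integrableOn_pow_mul_rpow_mul_exp_neg ha n).mul_const
    ((n.factorial : ℝ)⁻¹ * (Real.Gamma a)⁻¹)).congr (.of_forall fun g => ?_)
  simp only [coeff_rescale_exp]
  ring

/-- **Time-space harmonicity of the Laguerre polynomials with respect to the Gamma process
`G_t(1,1)`**: for `0 ≤ v < t`, averaging `L̃_k(x + ·, t)` against the Gamma distribution
with shape `t - v` and rate `1` yields `L̃_k(x, v)`. -/
theorem laguerre_tsh (v t : ℝ) (hv : 0 ≤ v) (hvt : v < t) :
    ∀ (k : ℕ) (x : ℝ),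
      ∫ g in Set.Ioi (0 : ℝ),
          laguerreTilde k (x + g) t *
            (g ^ (t - v - 1) * Real.exp (-g) / Real.Gamma (t - v))
        = laguerreTilde k x v := by
  intro k x
  have ha : 0 < t - v := sub_pos.mpr hvt
  set F := PowerSeries.rescale (-1) (PowerSeries.binomialSeries ℝ t) *
    PowerSeries.rescale x (PowerSeries.exp ℝ) with hF
  have h (g : ℝ) : laguerreTilde k (x + g) t *
      (g ^ (t - v - 1) * Real.exp (-g) / Real.Gamma (t - v)) =
      k.factorial * ∑ p ∈ Finset.HasAntidiagonal.antidiagonal k, F.coeff p.1 *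
        ((PowerSeries.rescale g (PowerSeries.exp ℝ)).coeff p.2 *
          (g ^ (t - v - 1) * Real.exp (-g) / Real.Gamma (t - v))) := by
    rw [laguerreTilde_eq_coeff, ← PowerSeries.exp_mul_exp_eq_exp_add, ← mul_assoc, ← hF,
      PowerSeries.coeff_mul, mul_assoc, Finset.sum_mul]
    simp_rw [mul_assoc]
  simp_rw [h]
  rw [integral_const_mul, integral_finsetSum _ fun p _ =>
    (integrableOn_coeff_rescale_exp_mul_gamma ha p.2).const_mul _]
  simp_rw [integral_const_mul, integral_coeff_rescale_exp_mul_gamma ha]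
  rw [← PowerSeries.coeff_mul, hF, mul_right_comm, ← map_mul, ← PowerSeries.binomialSeries_add,
    laguerreTilde_eq_coeff]
  congr 4
  ring_nf
end

section
/- Let 0 < p < 1, q = 1 − p. For t ∈ ℝ define M̃_k(x, t, p) := Σ_{j=0}^k binom(k,j) p^{−j} (x)_j (−x−t)_{k−j}, where (y)_j = y(y−1)⋯(y−j+1) is the falling factorial (so M̃_k(x,t,p) = (−1)^k (t)_k M_k(x,t,p) with M_k the Meixner polynomials of the first kind). Let 0 ≤ v < t. Then for every k ≥ 0 and x ∈ ℝ: Σ_{n=0}^∞ q^{t−v} p^n ((t−v)(t−v+1)⋯(t−v+n−1)/n!) · M̃_k(x + n, t, p) = M̃_k(x, v, p). -/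
open scoped BigOperators

/-- `M̃_k(x, t, p) = ∑_{j=0}^k C(k,j) p^{-j} (x)_j (-x-t)_{k-j}`, where `(y)_j` is the
falling factorial; so `M̃_k(x,t,p) = (-1)^k (t)_k M_k(x,t,p)` with `M_k` the Meixner
polynomials of the first kind. -/
noncomputable def meixnerTilde (k : ℕ) (x t p : ℝ) : ℝ :=
  ∑ j ∈ Finset.range (k + 1),
    (k.choose j : ℝ) * p ^ (-(j : ℤ)) * (descPochhammer ℝ j).eval x *
      (descPochhammer ℝ (k - j)).eval (-x - t)

/-- The probability of `n` under the negative binomial distribution with parameters `s`, `p`. -/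
noncomputable def pascalWeight (p s : ℝ) (n : ℕ) : ℝ :=
  (1 - p) ^ s * p ^ n * ((ascPochhammer ℝ n).eval s / (n.factorial : ℝ))

theorem hasSum_pascalWeight {p : ℝ} (hp0 : 0 < p) (hp1 : p < 1) (s : ℝ) :
    HasSum (pascalWeight p s) 1 := by
  have hmem : p ∈ Metric.eball (0 : ℝ) 1 := by
    rw [← ENNReal.ofReal_one, Metric.eball_ofReal]
    simpa [abs_of_pos hp0] using hp1
  have h := (Real.one_div_one_sub_rpow_hasFPowerSeriesOnBall_zero s).hasSum hmem
  have hq : (1 - p) ^ s ≠ 0 := (Real.rpow_pos_of_pos (sub_pos.2 hp1) s).ne'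
  convert! h.mul_left ((1 - p) ^ s) using 1
  · ext n
    have hchoose : Ring.choose (s + n - 1) n = (ascPochhammer ℝ n).eval s / (n.factorial : ℝ) := by
      rw [eq_div_iff (by positivity), mul_comm, ← nsmul_eq_mul, Ring.choose,
        Ring.factorial_nsmul_multichoose_eq_ascPochhammer,
        show s + n - 1 - n + 1 = s by ring, Polynomial.ascPochhammer_smeval_eq_eval]
    simp [pascalWeight, hchoose, mul_assoc]
  · simp [hq]

theorem pascalWeight_succ {p : ℝ} (hp1 : p < 1) (s : ℝ) (n : ℕ) :
    pascalWeight p s (n + 1) * ((n : ℝ) + 1) = p * (s / (1 - p)) * pascalWeight p (s + 1) n := by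
  have hq : 0 < 1 - p := sub_pos.2 hp1
  simp only [pascalWeight, ascPochhammer_succ_left, Real.rpow_add hq, Real.rpow_one,
    Nat.factorial_succ, Polynomial.eval_mul, Polynomial.eval_X, Polynomial.eval_comp,
    Polynomial.eval_add, Polynomial.eval_one]
  push_cast
  field_simp
  ring

theorem pascalWeight_mul_add {p : ℝ} (hp1 : p < 1) (s : ℝ) (n : ℕ) :
    pascalWeight p s n * (s + n) = s / (1 - p) * pascalWeight p (s + 1) n := by
  have hq : 0 < 1 - p := sub_pos.2 hp1
  have h : (ascPochhammer ℝ n).eval s * (s + n) = s * (ascPochhammer ℝ n).eval (s + 1) := by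
    rw [← ascPochhammer_succ_eval, ascPochhammer_succ_left]
    simp [Polynomial.eval_comp]
  simp only [pascalWeight, Real.rpow_add hq, Real.rpow_one]
  field_simp
  linear_combination p ^ n * h

theorem meixnerTilde_eq_sum_antidiagonal (k : ℕ) (x t p : ℝ) :
    meixnerTilde k x t p = ∑ ij ∈ Finset.HasAntidiagonal.antidiagonal k, (k.choose ij.1 : ℝ) *
      (p ^ (-(ij.1 : ℤ)) * (descPochhammer ℝ ij.1).eval x *
        (descPochhammer ℝ ij.2).eval (-x - t)) := by
  rw [Finset.Nat.sum_antidiagonal_eq_sum_range_succ_mk]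
  simp only [meixnerTilde, mul_assoc]

theorem meixnerTilde_succ {p : ℝ} (hp : p ≠ 0) (k : ℕ) (x t : ℝ) :
    meixnerTilde (k + 1) x t p =
      x / p * meixnerTilde k (x - 1) (t + 1) p - (x + t) * meixnerTilde k x (t + 1) p := by
  have hdesc (m : ℕ) (y : ℝ) :
      (descPochhammer ℝ (m + 1)).eval y = y * (descPochhammer ℝ m).eval (y - 1) := by
    simp [descPochhammer_succ_left, Polynomial.eval_comp]
  simp only [meixnerTilde_eq_sum_antidiagonal]
  rw [Finset.sum_antidiagonal_choose_succ_mul (fun i j ↦ p ^ (-(i : ℤ)) *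
    (descPochhammer ℝ i).eval x * (descPochhammer ℝ j).eval (-x - t)), add_comm,
    sub_eq_add_neg (x / p * _), ← neg_mul, Finset.mul_sum, Finset.mul_sum]
  congr 1 <;> refine Finset.sum_congr rfl fun ij hij ↦ ?_
  · rw [hdesc, ← Nat.choose_symm_of_eq_add (Finset.HasAntidiagonal.mem_antidiagonal.1 hij).symm,
      show -(x - 1) - (t + 1) = -x - t by ring, Nat.cast_succ, neg_add, zpow_add₀ hp, zpow_neg_one]
    ring
  · rw [hdesc, show -x - (t + 1) = -x - t - 1 by ring]
    ring

theorem hasSum_pascalWeight_mul_meixnerTilde {p : ℝ} (hp0 : 0 < p) (hp1 : p < 1)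
    (k : ℕ) (s v x : ℝ) :
    HasSum (fun n : ℕ ↦ pascalWeight p s n * meixnerTilde k (x + n) (v + s) p)
      (meixnerTilde k x v p) := by
  induction k generalizing s v x with
  | zero => simpa [meixnerTilde] using hasSum_pascalWeight hp0 hp1 s
  | succ k ih =>
    have hshift : HasSum (fun n : ℕ ↦ pascalWeight p s n *
        (n / p * meixnerTilde k (x + n - 1) (v + s + 1) p))
        (s / (1 - p) * meixnerTilde k x v p) := by
      rw [← hasSum_nat_add_iff' 1]
      simp only [Finset.sum_range_one, Nat.cast_zero, zero_div, zero_mul, mul_zero, sub_zero]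
      convert! (ih (s + 1) v x).mul_left (s / (1 - p)) using 2 with n
      have hw := pascalWeight_succ hp1 s n
      rw [Nat.cast_succ, show x + ((n : ℝ) + 1) - 1 = x + n by ring, ← add_assoc v s 1]
      field_simp at hw ⊢
      linear_combination meixnerTilde k (x + n) (v + s + 1) p * hw
    have hadd : HasSum (fun n : ℕ ↦ pascalWeight p s n *
        ((s + n) * meixnerTilde k (x + n) (v + s + 1) p))
        (s / (1 - p) * meixnerTilde k x v p) := by
      convert! (ih (s + 1) v x).mul_left (s / (1 - p)) using 2 with n
      rw [← mul_assoc, pascalWeight_mul_add hp1, mul_assoc, ← add_assoc v s 1]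
    have hpred := (ih s (v + 1) (x - 1)).mul_left (x / p)
    have hself := (ih s (v + 1) x).mul_left (x + v)
    rw [meixnerTilde_succ hp0.ne']
    convert! (hshift.sub hadd).add (hpred.sub hself) using 1
    · ext n
      rw [meixnerTilde_succ hp0.ne', show x - 1 + n = x + n - 1 by ring,
        show v + 1 + s = v + s + 1 by ring]
      ring
    · ring

/-- **Time-space harmonicity of the Meixner polynomials of the first kind with respect to
the Pascal process**: for `0 < p < 1`, `q = 1 - p` and `0 ≤ v < t`, averaging
`M̃_k(x + ·, t, p)` against the negative binomial distribution with parameters `t - v` and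
`p` yields `M̃_k(x, v, p)`. -/
theorem meixner_tsh (p : ℝ) (hp0 : 0 < p) (hp1 : p < 1) (q : ℝ) (hq : q = 1 - p)
    (v t : ℝ) (hv : 0 ≤ v) (hvt : v < t) :
    ∀ (k : ℕ) (x : ℝ),
      ∑' n : ℕ, q ^ (t - v) * p ^ n *
          ((ascPochhammer ℝ n).eval (t - v) / (n.factorial : ℝ)) *
          meixnerTilde k (x + n) t p
        = meixnerTilde k x v p := by
  intro k x
  subst hq
  simpa [pascalWeight] using
    (hasSum_pascalWeight_mul_meixnerTilde hp0 hp1 k (t - v) v x).tsum_eq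
end

section
/- Let 0 < p < 1, q = 1 − p. For an integer n ≥ 0 define K̃_k(x, n) := Σ_{j=0}^k binom(k,j) (−q/p)^j (x)_j (n−x)_{k−j}, where (y)_j = y(y−1)⋯(y−j+1) is the falling factorial (so K̃_k(x,n) = (n!/(n−k)!)·𝓚_k(x,p,n) with 𝓚_k the Krawtchouk polynomials). Then for all integers 0 ≤ m ≤ n, every k ≥ 0 and every x ∈ ℝ: Σ_{i=0}^{n−m} binom(n−m, i) p^i q^{n−m−i} · K̃_k(x + i, n) = K̃_k(x, m). -/
open scoped BigOperators

/-- `K̃_k(x, n) = ∑_{j=0}^k C(k,j) (-q/p)^j (x)_j (n-x)_{k-j}`, where `(y)_j` is the falling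
factorial; so `K̃_k(x,n) = (n!/(n-k)!) 𝓚_k(x,p,n)` with `𝓚_k` the Krawtchouk polynomials. -/
noncomputable def krawtchoukTilde (k : ℕ) (x : ℝ) (p q : ℝ) (n : ℕ) : ℝ :=
  ∑ j ∈ Finset.range (k + 1),
    (k.choose j : ℝ) * (-q / p) ^ j * (descPochhammer ℝ j).eval x *
      (descPochhammer ℝ (k - j)).eval ((n : ℝ) - x)

open Polynomial in
theorem descPochhammer_succ_eval_add_one (j : ℕ) (y : ℝ) :
    (descPochhammer ℝ (j + 1)).eval (y + 1) =
      (descPochhammer ℝ (j + 1)).eval y + (j + 1) * (descPochhammer ℝ j).eval y := by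
  have h := congrArg (eval (y + 1)) (descPochhammer_succ_comp_X_sub_one ℝ j)
  simp at h
  linarith

/-- The binomial-type convolution `∑_{j ≤ k} C(k,j) r^j (a)_j (b)_{k-j}` of falling factorials. -/
noncomputable def descPochhammerConv (r : ℝ) (k : ℕ) (a b : ℝ) : ℝ :=
  ∑ j ∈ Finset.range (k + 1),
    (k.choose j : ℝ) * r ^ j * (descPochhammer ℝ j).eval a * (descPochhammer ℝ (k - j)).eval b

theorem descPochhammerConv_add_one_left (r : ℝ) (k : ℕ) (a b : ℝ) :
    descPochhammerConv r (k + 1) (a + 1) b =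
      descPochhammerConv r (k + 1) a b + r * (k + 1) * descPochhammerConv r k a b := by
  unfold descPochhammerConv
  rw [Finset.sum_range_succ' _ (k + 1), Finset.sum_range_succ' _ (k + 1), Finset.mul_sum,
    add_right_comm, ← Finset.sum_add_distrib]
  congr 1
  · refine Finset.sum_congr rfl fun j _ ↦ ?_
    have h : ((k : ℝ) + 1) * k.choose j = (k + 1).choose (j + 1) * (j + 1) := by
      exact_mod_cast Nat.add_one_mul_choose_eq k j
    rw [descPochhammer_succ_eval_add_one, Nat.add_sub_add_right]
    linear_combination -r ^ (j + 1) * (descPochhammer ℝ j).eval a *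
      (descPochhammer ℝ (k - j)).eval b * h
  · simp

theorem descPochhammerConv_add_one_right (r : ℝ) (k : ℕ) (a b : ℝ) :
    descPochhammerConv r (k + 1) a (b + 1) =
      descPochhammerConv r (k + 1) a b + (k + 1) * descPochhammerConv r k a b := by
  unfold descPochhammerConv
  rw [Finset.sum_range_succ _ (k + 1), Finset.sum_range_succ _ (k + 1), Finset.mul_sum,
    add_right_comm, ← Finset.sum_add_distrib]
  congr 1
  · refine Finset.sum_congr rfl fun j hj ↦ ?_
    obtain ⟨l, rfl⟩ := Nat.exists_eq_add_of_le (Finset.mem_range_succ_iff.mp hj)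
    have h : (((j + l).choose j : ℕ) : ℝ) * (j + l + 1) = (j + l + 1).choose j * (l + 1) := by
      have := Nat.choose_mul_succ_eq (j + l) j
      rw [show j + l + 1 - j = l + 1 by lia] at this
      exact_mod_cast this
    rw [show j + l + 1 - j = l + 1 by lia, Nat.add_sub_cancel_left,
      descPochhammer_succ_eval_add_one]
    push_cast
    linear_combination -r ^ j * (descPochhammer ℝ j).eval a * (descPochhammer ℝ l).eval b * h
  · simp

theorem krawtchoukTilde_eq_descPochhammerConv (k : ℕ) (x p q : ℝ) (n : ℕ) :
    krawtchoukTilde k x p q n = descPochhammerConv (-q / p) k x (n - x) := rfl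

/-- One-step harmonicity: conditioning on a single Bernoulli(`p`) increment. -/
theorem krawtchoukTilde_succ_average {p q : ℝ} (hp : p ≠ 0) (hq : q = 1 - p)
    (k : ℕ) (x : ℝ) (n : ℕ) :
    q * krawtchoukTilde k x p q (n + 1) + p * krawtchoukTilde k (x + 1) p q (n + 1) =
      krawtchoukTilde k x p q n := by
  simp only [krawtchoukTilde_eq_descPochhammerConv]
  rw [show ((n + 1 : ℕ) : ℝ) - x = n - x + 1 by push_cast; ring,
    show ((n + 1 : ℕ) : ℝ) - (x + 1) = n - x by push_cast; ring]
  cases k with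
  | zero => simp [descPochhammerConv, hq]
  | succ k =>
    rw [descPochhammerConv_add_one_left, descPochhammerConv_add_one_right]
    have hr : p * (-q / p) = -q := mul_div_cancel₀ _ hp
    linear_combination (k + 1) * descPochhammerConv (-q / p) k x (n - x) * hr +
      descPochhammerConv (-q / p) (k + 1) x (n - x) * hq

theorem sum_range_choose_mul_pow_succ (p q : ℝ) (N : ℕ) (f : ℕ → ℝ) :
    ∑ i ∈ Finset.range (N + 1 + 1), ((N + 1).choose i : ℝ) * p ^ i * q ^ (N + 1 - i) * f i =
      ∑ i ∈ Finset.range (N + 1),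
        (N.choose i : ℝ) * p ^ i * q ^ (N - i) * (q * f i + p * f (i + 1)) := by
  have h := Finset.sum_antidiagonal_choose_succ_mul (fun i j ↦ p ^ i * q ^ j * f i) N
  simp only [Finset.Nat.sum_antidiagonal_eq_sum_range_succ_mk] at h
  simp only [mul_assoc] at h ⊢
  rw [h, ← Finset.sum_add_distrib]
  refine Finset.sum_congr rfl fun i hi ↦ ?_
  rw [Nat.choose_symm (Finset.mem_range_succ_iff.mp hi)]
  ring

/-- **Time-space harmonicity of the Krawtchouk polynomials with respect to the Bernoulli(p)
random walk**: for `0 < p < 1`, `q = 1 - p` and `0 ≤ m ≤ n`,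
`∑_{i=0}^{n-m} C(n-m, i) p^i q^{n-m-i} K̃_k(x + i, n) = K̃_k(x, m)`. -/
theorem krawtchouk_tsh (p : ℝ) (hp0 : 0 < p) (hp1 : p < 1) (q : ℝ) (hq : q = 1 - p)
    (m n : ℕ) (hmn : m ≤ n) :
    ∀ (k : ℕ) (x : ℝ),
      ∑ i ∈ Finset.range (n - m + 1),
          ((n - m).choose i : ℝ) * p ^ i * q ^ (n - m - i) *
            krawtchoukTilde k (x + i) p q n
        = krawtchoukTilde k x p q m := by
  intro k
  obtain ⟨N, rfl⟩ := Nat.exists_eq_add_of_le hmn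
  rw [Nat.add_sub_cancel_left]
  clear hmn
  induction N with
  | zero => intro x; simp
  | succ N ih =>
    intro x
    rw [sum_range_choose_mul_pow_succ, ← ih x]
    refine Finset.sum_congr rfl fun i _ ↦ ?_
    rw [← krawtchoukTilde_succ_average hp0.ne' hq k (x + i) (m + N), Nat.cast_add_one,
      ← add_assoc, ← add_assoc]
end
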